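/- arXiv:2001.00743 — 5 statements merged into one kernel-verified Lean document; each statement's English description precedes it below -/
import Mathlib

section
/- Let k ≥ 2, 1 ≤ a ≤ k−1, m ≥ 1, and let λ = (m^a) be the rectangular partition with a rows of length m. Let a ≤ a′ ≤ k−1 and let c_a ≥ c_{a+1} ≥ … ≥ c_{a′} be integers with m ≥ c_a and c_{a′} ≥ 0; set c_{a−1} := m and c_{a′+1} := 0. Then the tableau T := f̃_{a′}^{c_{a′}} ⋯ f̃_{a+1}^{c_{a+1}} f̃_a^{c_a}(T_λ) is a nonzero element of SSYT(λ, k), and its word w_T satisfies: w_T^{−1}(i) = {(i−1)m+1, …, im} for all 1 ≤ i ≤ a−1, and w_T^{−1}(i) = {(a−1)m + c_i + 1, …, (a−1)m + c_{i−1}} for all a ≤ i ≤ a′+1. -/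
/-!
Semistandard Young tableaux are encoded by their "reading words"
`w : ℕ → ℕ`:  the boxes of the shape `μ` are labelled `1, …, |μ|`, the boxes
of row `i` (`i = 1, 2, …`) receiving the labels
`μ₁ + ⋯ + μ_{i-1} + 1, …, μ₁ + ⋯ + μ_i`, increasing from right to left within
each row, and `w j` is the entry of the box labelled `j` (with `w j = 0`
outside the labels `1, …, |μ|`).  A vanished tableau (`0`) is represented by
`none : Option (ℕ → ℕ)`.
-/

namespace CST

/-- `μ₁ + ⋯ + μ_r`. -/
def shapePrefix (μ : List ℕ) (r : ℕ) : ℕ := (μ.take r).sum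

/-- The entry of the filling with reading word `w` in row `r + 1` and column
`c` (columns numbered from the left, `1 ≤ c ≤ μ_{r+1}`). -/
def entryAt (μ : List ℕ) (w : ℕ → ℕ) (r c : ℕ) : ℕ :=
  w (shapePrefix μ r + μ.getD r 0 + 1 - c)

/-- `w` is the reading word of a semistandard Young tableau of shape `μ` with
entries in `{1, …, k}`: entries lie in `{1, …, k}`, rows weakly increase,
columns strictly increase, and `w` vanishes outside the labels `1, …, |μ|`. -/
def IsSSYT (μ : List ℕ) (k : ℕ) (w : ℕ → ℕ) : Prop :=
  (∀ r c, r < μ.length → 1 ≤ c → c ≤ μ.getD r 0 →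
      1 ≤ entryAt μ w r c ∧ entryAt μ w r c ≤ k) ∧
  (∀ r c, r < μ.length → 1 ≤ c → c < μ.getD r 0 →
      entryAt μ w r c ≤ entryAt μ w r (c + 1)) ∧
  (∀ r c, r + 1 < μ.length → 1 ≤ c → c ≤ μ.getD (r + 1) 0 →
      entryAt μ w r c < entryAt μ w (r + 1) c) ∧
  (∀ j, j = 0 ∨ μ.sum < j → w j = 0)

/-- One step of the bracketing procedure for the letters `i, i + 1`:  `acc`
is the stack of labels of currently unmatched letters `i` (most recent
first); a letter `i + 1` matches (and removes) the most recent unmatched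
`i`. -/
def scanStep (i : ℕ) (w : ℕ → ℕ) (acc : List ℕ) (j : ℕ) : List ℕ :=
  if w j = i then j :: acc
  else if w j = i + 1 then acc.drop 1
  else acc

/-- The labels of the unmatched letters `i` of `w` after the iterated removal
of consecutive pairs `i … i+1` (scanning the labels `1, …, n` in order). -/
def unmatched (n i : ℕ) (w : ℕ → ℕ) : List ℕ :=
  ((List.range n).map (· + 1)).foldl (scanStep i w) []

/-- The Kashiwara lowering operator `f̃ᵢ` on fillings with `n` boxes:  if
some letter `i` is unmatched, change the one with the smallest label to
`i + 1`; otherwise the result is `0` (i.e. `none`). -/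
def fTilde (n i : ℕ) : Option (ℕ → ℕ) → Option (ℕ → ℕ)
  | none => none
  | some w =>
    match (unmatched n i w).min? with
    | none => none
    | some j => some (Function.update w j (i + 1))

/-- `f̃_{a'}^{c_{a'}} ⋯ f̃_{a+1}^{c_{a+1}} f̃_a^{c_a} T`. -/
def chainPow (n : ℕ) (c : ℕ → ℕ) (a a' : ℕ) (T : Option (ℕ → ℕ)) : Option (ℕ → ℕ) :=
  (List.range (a' + 1 - a)).foldl (fun t r => (fTilde n (a + r))^[c (a + r)] t) T

/-- `f̃_{i_r} ⋯ f̃_{i_1} T` for `is = [i_1, …, i_r]`. -/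
def applySeq (n : ℕ) (is : List ℕ) (T : Option (ℕ → ℕ)) : Option (ℕ → ℕ) :=
  is.foldl (fun t i => fTilde n i t) T

/-- The highest weight tableau `T_μ`: every entry of row `i` equals `i`. -/
def highestWord (μ : List ℕ) (j : ℕ) : ℕ :=
  if 1 ≤ j ∧ j ≤ μ.sum then
    ((List.range μ.length).filter fun r => shapePrefix μ (r + 1) < j).length + 1
  else 0

/-- If every letter `i + 1` precedes every letter `i`, no letter `i` gets matched. -/
theorem mem_unmatched_of_succ_before {i : ℕ} {w : ℕ → ℕ}
    (h : ∀ x y, w x = i → w y = i + 1 → y < x) (n x : ℕ) :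
    x ∈ unmatched n i w ↔ w x = i ∧ 1 ≤ x ∧ x ≤ n := by
  induction n generalizing x with
  | zero => simp [unmatched]; omega
  | succ n ih =>
    have hstep : unmatched (n + 1) i w = scanStep i w (unmatched n i w) (n + 1) := by
      simp [unmatched, List.range_succ]
    rw [hstep, scanStep]
    split_ifs with h1 h2
    · rw [List.mem_cons, ih]
      constructor
      · rintro (rfl | h) <;> omega
      · rintro ⟨h, h', h''⟩
        by_cases hx : x = n + 1 <;> omega
    · have hnil : unmatched n i w = [] := by
        rw [List.eq_nil_iff_forall_not_mem]
        intro y hy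
        have hy' := (ih y).1 hy
        have := h y _ hy'.1 h2
        omega
      rw [hnil]
      simp only [List.drop_nil, List.not_mem_nil, false_iff]
      rintro ⟨h3, -, h4⟩
      have := h x _ h3 h2
      omega
    · rw [ih]
      constructor
      · omega
      · rintro ⟨h, h', h''⟩
        have : x ≠ n + 1 := by rintro rfl; exact h1 h
        omega

theorem fTilde_some_of_succ_before {n i p : ℕ} {w : ℕ → ℕ}
    (h : ∀ x y, w x = i → w y = i + 1 → y < x) (hp : w p = i) (hp1 : 1 ≤ p) (hpn : p ≤ n)
    (hmin : ∀ x, w x = i → p ≤ x) :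
    fTilde n i (some w) = some (Function.update w p (i + 1)) := by
  have hm : (unmatched n i w).min? = some p := by
    rw [List.min?_eq_some_iff]
    simp only [mem_unmatched_of_succ_before h]
    exact ⟨⟨hp, hp1, hpn⟩, fun x hx => hmin x hx.1⟩
  simp only [fTilde, hm]

/-- If the letters `i` occupy the labels `p + 1, …, q` and `i + 1` does not occur, then
`f̃ᵢ^t` changes the letters at the labels `p + 1, …, p + t`. -/
theorem iterate_fTilde_of_interval {n i p q : ℕ} {w : ℕ → ℕ}
    (hw : ∀ x, w x = i ↔ p < x ∧ x ≤ q) (hw' : ∀ x, w x ≠ i + 1) (hq : q ≤ n)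
    (t : ℕ) (ht : p + t ≤ q) :
    (fTilde n i)^[t] (some w) =
      some (fun x => if p < x ∧ x ≤ p + t then i + 1 else w x) := by
  induction t with
  | zero =>
    simp only [Function.iterate_zero, id_eq, Option.some.injEq]
    funext x
    rw [if_neg (by omega)]
  | succ t ih =>
    rw [Function.iterate_succ_apply', ih (by omega)]
    have hi : ∀ x, (if p < x ∧ x ≤ p + t then i + 1 else w x) = i ↔ p + t < x ∧ x ≤ q := by
      intro x
      split_ifs with hx
      · omega
      · rw [hw]; omega
    have hi' : ∀ x, (if p < x ∧ x ≤ p + t then i + 1 else w x) = i + 1 → x ≤ p + t := by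
      intro x
      split_ifs with hx
      · omega
      · exact fun h => absurd h (hw' x)
    rw [fTilde_some_of_succ_before (p := p + t + 1)]
    · congr 1
      funext x
      by_cases hx : x = p + t + 1
      · subst hx
        rw [Function.update_self, if_pos (by omega)]
      · rw [Function.update_of_ne hx]
        by_cases hx' : p < x ∧ x ≤ p + t
        · rw [if_pos hx', if_pos (by omega)]
        · rw [if_neg hx', if_neg (by omega)]
    · intro x y hx hy
      have := (hi x).1 hx
      have := hi' y hy
      omega
    · exact (hi _).2 (by omega)
    · omega
    · omega
    · intro x hx
      have := (hi x).1 hx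
      omega

theorem length_filter_range_lt (a q : ℕ) :
    ((List.range a).filter fun r => r < q).length = min a q := by
  induction a with
  | zero => simp
  | succ a ih =>
    rw [List.range_succ, List.filter_append, List.length_append, ih]
    by_cases h : a < q
    · simp [h]; omega
    · simp [h]; omega

theorem shapePrefix_replicate (a m r : ℕ) :
    shapePrefix (List.replicate a m) r = min r a * m := by
  simp [shapePrefix, List.take_replicate]

theorem highestWord_replicate {a m j : ℕ} (hj : 1 ≤ j) (hja : j ≤ a * m) :
    highestWord (List.replicate a m) j = (j - 1) / m + 1 := by
  have hm : 0 < m := by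
    rcases Nat.eq_zero_or_pos m with rfl | h
    · omega
    · exact h
  have hq : (j - 1) / m < a := by
    rw [Nat.div_lt_iff_lt_mul hm]; omega
  have hf : ((List.range a).filter fun r => shapePrefix (List.replicate a m) (r + 1) < j) =
      (List.range a).filter fun r => r < (j - 1) / m := by
    apply List.filter_congr
    intro r hr
    rw [List.mem_range] at hr
    rw [shapePrefix_replicate, min_eq_left (by omega), decide_eq_decide,
      ← Nat.add_one_le_iff (n := r), Nat.le_div_iff_mul_le hm]
    omega
  rw [highestWord, if_pos (by simpa using ⟨hj, hja⟩), List.length_replicate, hf,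
    length_filter_range_lt]
  omega

theorem highestWord_replicate_eq_zero {a m j : ℕ} (hj : j = 0 ∨ a * m < j) :
    highestWord (List.replicate a m) j = 0 := by
  rw [highestWord, if_neg]
  simp only [List.sum_replicate, smul_eq_mul]
  omega

theorem pred_div_add_one_eq_iff {m i j : ℕ} (hm : 1 ≤ m) (hj : 1 ≤ j) (hi : 1 ≤ i) :
    (j - 1) / m + 1 = i ↔ (i - 1) * m + 1 ≤ j ∧ j ≤ i * m := by
  obtain ⟨i, rfl⟩ := Nat.exists_eq_add_of_le' hi
  rw [Nat.add_right_cancel_iff, Nat.div_eq_iff (by omega), Nat.add_sub_cancel, add_mul, one_mul]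
  omega

/-- The shape of the word after the operators `f̃_{b+1}, …, f̃_{b+s}` were applied to the
highest weight tableau of shape `(m^{b+1})`. -/
structure IsChainWord (b m : ℕ) (c : ℕ → ℕ) (s : ℕ) (w : ℕ → ℕ) : Prop where
  outside : ∀ j, j = 0 ∨ b * m + m < j → w j = 0
  upper : ∀ j, 1 ≤ j → j ≤ b * m → w j = (j - 1) / m + 1
  lower : ∀ j, b * m < j → j ≤ b * m + m → b + 1 ≤ w j ∧ w j ≤ b + 1 + s
  anti : ∀ x y, b * m < x → x ≤ y → y ≤ b * m + m → w y ≤ w x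
  fiber : ∀ i, b + 1 ≤ i → i < b + 1 + s →
    ∀ j, w j = i ↔ b * m + c i < j ∧ j ≤ b * m + c (i - 1)
  last : ∀ j, w j = b + 1 + s ↔ b * m < j ∧ j ≤ b * m + c (b + s)

theorem isChainWord_highestWord {b m : ℕ} {c : ℕ → ℕ} (hm : 1 ≤ m) (hc : c b = m) :
    IsChainWord b m c 0 (highestWord (List.replicate (b + 1) m)) := by
  have hout : ∀ j, j = 0 ∨ b * m + m < j → highestWord (List.replicate (b + 1) m) j = 0 :=
    fun j hj => highestWord_replicate_eq_zero (by rwa [add_mul, one_mul])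
  have hin : ∀ j, 1 ≤ j → j ≤ b * m + m →
      highestWord (List.replicate (b + 1) m) j = (j - 1) / m + 1 :=
    fun j hj hj' => highestWord_replicate hj (by rwa [add_mul, one_mul])
  have hlast : ∀ j, highestWord (List.replicate (b + 1) m) j = b + 1 ↔
      b * m < j ∧ j ≤ b * m + m := by
    intro j
    by_cases hj : j = 0 ∨ b * m + m < j
    · rw [hout j hj]; omega
    · rw [hin j (by omega) (by omega), pred_div_add_one_eq_iff hm (by omega) (by omega),
        Nat.add_sub_cancel, add_mul, one_mul]
      omega
  refine ⟨hout, fun j h1 h2 => hin j h1 (by omega), fun j h1 h2 => ?_,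
    fun x y h1 h2 h3 => ?_, fun i h1 h2 => by omega, fun j => ?_⟩
  · have := (hlast j).2 ⟨h1, h2⟩
    omega
  · rw [(hlast x).2 ⟨h1, by omega⟩, (hlast y).2 ⟨by omega, h3⟩]
  · simpa [hc] using hlast j

theorem IsChainWord.le {b m s : ℕ} {c w : ℕ → ℕ} (h : IsChainWord b m c s w) (hm : 1 ≤ m)
    (j : ℕ) : w j ≤ b + 1 + s := by
  by_cases h0 : j = 0 ∨ b * m + m < j
  · rw [h.outside j h0]; omega
  · by_cases h1 : j ≤ b * m
    · rw [h.upper j (by omega) h1]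
      have : (j - 1) / m < b := by
        rw [Nat.div_lt_iff_lt_mul (by omega)]; omega
      omega
    · exact (h.lower j (by omega) (by omega)).2

theorem IsChainWord.step {b m s : ℕ} {c w : ℕ → ℕ} (h : IsChainWord b m c s w) (hm : 1 ≤ m)
    (hc : c (b + 1 + s) ≤ c (b + s)) (hcm : c (b + s) ≤ m) :
    ∃ w', (fTilde ((b + 1) * m) (b + 1 + s))^[c (b + 1 + s)] (some w) = some w' ∧
      IsChainWord b m c (s + 1) w' := by
  refine ⟨_, iterate_fTilde_of_interval h.last (fun x => ?_) ?_ _ (by omega), ?_⟩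
  · have := h.le hm x
    omega
  · rw [add_mul, one_mul]; omega
  · constructor
    · intro j hj
      rw [if_neg (by omega), h.outside j hj]
    · intro j h1 h2
      rw [if_neg (by omega), h.upper j h1 h2]
    · intro j h1 h2
      have := h.lower j h1 h2
      split_ifs <;> omega
    · intro x y h1 h2 h3
      have := h.anti x y h1 h2 h3
      have := h.le hm y
      split_ifs <;> omega
    · intro i h1 h2 j
      by_cases hi : i = b + 1 + s
      · subst hi
        have := h.last j
        rw [show b + 1 + s - 1 = b + s by omega]
        split_ifs <;> omega
      · have hf := h.fiber i h1 (by omega) j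
        split_ifs with hx
        · have hl := (h.last j).2 ⟨hx.1, by omega⟩
          omega
        · exact hf
    · intro j
      have := h.le hm j
      rw [show b + (s + 1) = b + 1 + s by omega]
      split_ifs <;> omega

theorem IsChainWord.isSSYT {b m s k : ℕ} {c w : ℕ → ℕ} (h : IsChainWord b m c s w)
    (hm : 1 ≤ m) (hk : b + 1 + s ≤ k) : IsSSYT (List.replicate (b + 1) m) k w := by
  have hentry : ∀ r c', r < b + 1 →
      entryAt (List.replicate (b + 1) m) w r c' = w (r * m + m + 1 - c') := by
    intro r c' hr
    rw [entryAt, shapePrefix_replicate, min_eq_left (by omega), List.getD_replicate _ hr]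
  have hup : ∀ r c', r < b → 1 ≤ c' → c' ≤ m → w (r * m + m + 1 - c') = r + 1 := by
    intro r c' hr h1 h2
    have hrb : (r + 1) * m ≤ b * m := Nat.mul_le_mul_right m hr
    rw [add_mul, one_mul] at hrb
    rw [h.upper _ (by omega) (by omega), pred_div_add_one_eq_iff hm (by omega) (by omega),
      Nat.add_sub_cancel, add_mul, one_mul]
    omega
  refine ⟨fun r c' hr h1 h2 => ?_, fun r c' hr h1 h2 => ?_, fun r c' hr h1 h2 => ?_,
    fun j hj => ?_⟩
  · rw [List.length_replicate] at hr
    rw [List.getD_replicate _ hr] at h2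
    rw [hentry r c' hr]
    rcases Nat.lt_succ_iff_lt_or_eq.1 hr with hr | rfl
    · rw [hup r c' hr h1 h2]; omega
    · have := h.lower (r * m + m + 1 - c') (by omega) (by omega)
      omega
  · rw [List.length_replicate] at hr
    rw [List.getD_replicate _ hr] at h2
    rw [hentry r c' hr, hentry r _ hr]
    rcases Nat.lt_succ_iff_lt_or_eq.1 hr with hr | rfl
    · rw [hup r c' hr h1 h2.le, hup r _ hr (by omega) h2]
    · exact h.anti _ _ (by omega) (by omega) (by omega)
  · rw [List.length_replicate] at hr
    rw [List.getD_replicate _ hr] at h2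
    rw [hentry r c' (by omega), hentry _ _ hr, hup r c' (by omega) h1 h2]
    rcases Nat.lt_succ_iff_lt_or_eq.1 hr with hr | hr
    · rw [hup _ c' hr h1 h2]; omega
    · rw [hr]
      have := h.lower (b * m + m + 1 - c') (by omega) (by omega)
      omega
  · apply h.outside
    rwa [List.sum_replicate, smul_eq_mul, add_mul, one_mul] at hj

theorem IsChainWord.eq_iff_of_le {b m s i : ℕ} {c w : ℕ → ℕ} (h : IsChainWord b m c s w)
    (hm : 1 ≤ m) (hi : 1 ≤ i) (hib : i ≤ b) (j : ℕ) :
    w j = i ↔ (i - 1) * m + 1 ≤ j ∧ j ≤ i * m := by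
  have hle : i * m ≤ b * m := Nat.mul_le_mul_right m hib
  by_cases h0 : j = 0 ∨ b * m + m < j
  · rw [h.outside j h0]; omega
  · by_cases h1 : j ≤ b * m
    · rw [h.upper j (by omega) h1, pred_div_add_one_eq_iff hm (by omega) hi]
    · have := h.lower j (by omega) (by omega)
      omega

theorem exists_chainPow_isChainWord {b m s : ℕ} {c : ℕ → ℕ} (hm : 1 ≤ m) (hb : c b = m)
    (hc : ∀ r < s, c (b + 1 + r) ≤ c (b + r)) :
    c (b + s) ≤ m ∧ ∃ w, (List.range s).foldl
        (fun t r => (fTilde ((b + 1) * m) (b + 1 + r))^[c (b + 1 + r)] t)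
        (some (highestWord (List.replicate (b + 1) m))) = some w ∧
      IsChainWord b m c s w := by
  induction s with
  | zero => exact ⟨hb.le, _, rfl, isChainWord_highestWord hm hb⟩
  | succ s ih =>
    obtain ⟨hcm, w, hw, h⟩ := ih fun r hr => hc r (by omega)
    have hs := hc s (by omega)
    obtain ⟨w', hw', h'⟩ := h.step hm hs hcm
    refine ⟨?_, w', ?_, h'⟩
    · rw [show b + (s + 1) = b + 1 + s by omega]; omega
    · rw [List.range_succ, List.foldl_append, hw]
      exact hw'

/-- Lemma `expl`:  for the rectangular shape `λ = (m^a)`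
(`1 ≤ a ≤ k - 1`), `a ≤ a' ≤ k - 1`, and `m = c_{a-1} ≥ c_a ≥ ⋯ ≥ c_{a'} ≥ 0
= c_{a'+1}`, the tableau `T = f̃_{a'}^{c_{a'}} ⋯ f̃_a^{c_a}(T_λ)` is a nonzero
semistandard tableau of shape `λ` with entries in `{1, …, k}` whose word
satisfies `w_T⁻¹(i) = {(i-1)m + 1, …, im}` for `1 ≤ i ≤ a - 1` and
`w_T⁻¹(i) = {(a-1)m + c_i + 1, …, (a-1)m + c_{i-1}}` for `a ≤ i ≤ a' + 1`. -/
theorem chain_on_highest_weight_tableau_explicit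
    (k a m a' : ℕ) (hk : 2 ≤ k) (ha : 1 ≤ a) (hak : a ≤ k - 1) (hm : 1 ≤ m)
    (haa' : a ≤ a') (ha'k : a' ≤ k - 1)
    (c : ℕ → ℕ) (hca : c a ≤ m) (hmono : ∀ i, a ≤ i → i < a' → c (i + 1) ≤ c i)
    (hlo : c (a - 1) = m) (hhi : c (a' + 1) = 0) :
    ∃ w : ℕ → ℕ,
      chainPow (a * m) c a a' (some (highestWord (List.replicate a m))) = some w ∧
      IsSSYT (List.replicate a m) k w ∧
      (∀ i, 1 ≤ i → i ≤ a - 1 →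
        ∀ j, w j = i ↔ ((i - 1) * m + 1 ≤ j ∧ j ≤ i * m)) ∧
      (∀ i, a ≤ i → i ≤ a' + 1 →
        ∀ j, w j = i ↔ ((a - 1) * m + c i + 1 ≤ j ∧ j ≤ (a - 1) * m + c (i - 1))) := by
  obtain ⟨b, rfl⟩ := Nat.exists_eq_add_of_le' ha
  obtain ⟨d, rfl⟩ := Nat.exists_eq_add_of_le haa'
  rw [Nat.add_sub_cancel] at hlo
  have hc : ∀ r < d + 1, c (b + 1 + r) ≤ c (b + r) := by
    intro r hr
    rcases r with _ | r
    · simpa [hlo] using hca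
    · have := hmono (b + 1 + r) (by omega) (by omega)
      rwa [show b + (r + 1) = b + 1 + r by omega]
  obtain ⟨-, w, hw, h⟩ := exists_chainPow_isChainWord hm hlo hc
  refine ⟨w, ?_, h.isSSYT hm (by omega), fun i h1 h2 => h.eq_iff_of_le hm h1 (by omega),
    fun i h1 h2 j => ?_⟩
  · rw [chainPow, show b + 1 + d + 1 - (b + 1) = d + 1 by omega]
    exact hw
  · rw [Nat.add_sub_cancel]
    by_cases hi : i = b + 1 + d + 1
    · subst hi
      rw [hhi, Nat.add_sub_cancel]
      have := h.last j
      rw [show b + (d + 1) = b + 1 + d by omega] at this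
      omega
    · have := h.fiber i h1 (by omega) j
      omega

end CST
end

section
/- Let k ≥ 2, 1 ≤ a ≤ k−1, m ≥ 1, and let λ = (m^a) be the rectangular partition with a rows of length m. For all a ≤ a′ ≤ k−1 and all nonnegative integers c_a, c_{a+1}, …, c_{a′}, the tableau f̃_{a′}^{c_{a′}} ⋯ f̃_{a+1}^{c_{a+1}} f̃_a^{c_a}(T_λ) is nonzero if and only if m ≥ c_a ≥ c_{a+1} ≥ ⋯ ≥ c_{a′} ≥ 0. -/
/-!
Semistandard Young tableaux are encoded by their "reading words"
`w : ℕ → ℕ`:  the boxes of the shape `μ` are labelled `1, …, |μ|`, the boxes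
of row `i` (`i = 1, 2, …`) receiving the labels
`μ₁ + ⋯ + μ_{i-1} + 1, …, μ₁ + ⋯ + μ_i`, increasing from right to left within
each row, and `w j` is the entry of the box labelled `j` (with `w j = 0`
outside the labels `1, …, |μ|`).  A vanished tableau (`0`) is represented by
`none : Option (ℕ → ℕ)`.
-/

namespace CST

/-- The letters at the labels `p + 1, …, p + b` are first `d` letters `i + 1`, then `b - d`
letters `i`; all other letters are smaller than `i`. -/
def IsStaircase (p b d i : ℕ) (w : ℕ → ℕ) : Prop :=
  ∀ j, (p < j → j ≤ p + d → w j = i + 1) ∧ (p + d < j → j ≤ p + b → w j = i) ∧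
    (j ≤ p ∨ p + b < j → w j < i)

lemma mem_unmatched_iff {p b d i : ℕ} {w : ℕ → ℕ} (hw : IsStaircase p b d i w)
    (n j : ℕ) : j ∈ unmatched n i w ↔ j ≤ n ∧ p + d < j ∧ j ≤ p + b := by
  induction n generalizing j with
  | zero =>
    simp only [unmatched, List.range_zero, List.map_nil, List.foldl_nil, List.not_mem_nil,
      false_iff]
    omega
  | succ n ih =>
    have hstep : unmatched (n + 1) i w = scanStep i w (unmatched n i w) (n + 1) := by
      simp [unmatched, List.range_succ]
    obtain ⟨h₁, h₂, h₃⟩ := hw (n + 1)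
    rw [hstep, scanStep]
    split_ifs with hi hi'
    · rw [List.mem_cons, ih]
      omega
    · have hnil : unmatched n i w = [] := by
        refine List.eq_nil_iff_forall_not_mem.2 fun x hx => ?_
        rw [ih] at hx
        omega
      simp only [hnil, List.drop_nil, List.not_mem_nil, false_iff]
      omega
    · rw [ih]
      omega

lemma IsStaircase.update {p b d i : ℕ} {w : ℕ → ℕ} (hw : IsStaircase p b d i w) (hd : d < b) :
    IsStaircase p b (d + 1) i (Function.update w (p + d + 1) (i + 1)) := by
  intro j
  obtain ⟨h₁, h₂, h₃⟩ := hw j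
  rw [Function.update_apply]
  split_ifs <;> omega

/-- Once all letters `i` have become `i + 1`, these are the letters to be lowered next. -/
lemma IsStaircase.next {p b d i : ℕ} {w : ℕ → ℕ} (hw : IsStaircase p b d i w) :
    IsStaircase p d 0 (i + 1) w := by
  intro j
  obtain ⟨h₁, h₂, h₃⟩ := hw j
  omega

lemma fTilde_of_lt {n p b d i : ℕ} {w : ℕ → ℕ} (hw : IsStaircase p b d i w) (hd : d < b)
    (hn : p + b ≤ n) :
    fTilde n i (some w) = some (Function.update w (p + d + 1) (i + 1)) := by
  have hmin : (unmatched n i w).min? = some (p + d + 1) := by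
    rw [List.min?_eq_some_iff]
    refine ⟨(mem_unmatched_iff hw n _).2 (by omega), fun x hx => ?_⟩
    rw [mem_unmatched_iff hw] at hx
    omega
  simp [fTilde, hmin]

lemma fTilde_of_eq {n p b i : ℕ} {w : ℕ → ℕ} (hw : IsStaircase p b b i w) :
    fTilde n i (some w) = none := by
  have hnil : unmatched n i w = [] := by
    refine List.eq_nil_iff_forall_not_mem.2 fun x hx => ?_
    rw [mem_unmatched_iff hw] at hx
    omega
  simp [fTilde, hnil]

lemma iterate_fTilde_none (n i d : ℕ) : (fTilde n i)^[d] none = none :=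
  Function.iterate_fixed rfl d

lemma exists_iterate_fTilde {n p b i : ℕ} {w : ℕ → ℕ} (hw : IsStaircase p b 0 i w)
    (hn : p + b ≤ n) {d : ℕ} (hd : d ≤ b) :
    ∃ w', (fTilde n i)^[d] (some w) = some w' ∧ IsStaircase p b d i w' := by
  induction d with
  | zero => exact ⟨w, rfl, hw⟩
  | succ d ih =>
    obtain ⟨w', hw', hs⟩ := ih (by omega)
    exact ⟨_, by rw [Function.iterate_succ_apply', hw', fTilde_of_lt hs hd hn], hs.update hd⟩

lemma iterate_fTilde_eq_none {n p b i : ℕ} {w : ℕ → ℕ} (hw : IsStaircase p b 0 i w)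
    (hn : p + b ≤ n) {d : ℕ} (hd : b < d) : (fTilde n i)^[d] (some w) = none := by
  obtain ⟨w', hw', hs⟩ := exists_iterate_fTilde hw hn le_rfl
  obtain ⟨e, rfl⟩ : ∃ e, d = e + (b + 1) := ⟨d - (b + 1), by omega⟩
  rw [Function.iterate_add_apply, Function.iterate_succ_apply', hw', fTilde_of_eq hs,
    iterate_fTilde_none]

/-- Here `b 0` is the number of letters `a` at the start, and `b (r + 1)` is the exponent of
`f̃_{a + r}`. -/
lemma foldl_iterate_fTilde {n p a : ℕ} {w : ℕ → ℕ} (b : ℕ → ℕ) (hw : IsStaircase p (b 0) 0 a w)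
    (hn : p + b 0 ≤ n) (t : ℕ) :
    ((∀ r < t, b (r + 1) ≤ b r) → b t ≤ b 0 ∧
      ∃ w', (List.range t).foldl (fun T r => (fTilde n (a + r))^[b (r + 1)] T) (some w) = some w' ∧
        IsStaircase p (b t) 0 (a + t) w') ∧
    ((¬ ∀ r < t, b (r + 1) ≤ b r) →
      (List.range t).foldl (fun T r => (fTilde n (a + r))^[b (r + 1)] T) (some w) = none) := by
  induction t with
  | zero => exact ⟨fun _ => ⟨le_rfl, w, rfl, hw⟩, fun h => absurd (by simp) h⟩
  | succ t ih =>
    simp only [List.range_succ, List.foldl_append, List.foldl_cons, List.foldl_nil]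
    by_cases ht : ∀ r < t, b (r + 1) ≤ b r
    · obtain ⟨hb, w', hw', hs⟩ := ih.1 ht
      rw [hw']
      constructor
      · intro h
        have hle := h t (by omega)
        obtain ⟨w'', hw'', hs'⟩ := exists_iterate_fTilde (n := n) hs (by omega) hle
        exact ⟨hle.trans hb, w'', hw'', hs'.next⟩
      · intro h
        refine iterate_fTilde_eq_none hs (by omega) (not_le.1 fun hle => h fun r hr => ?_)
        obtain hr' | rfl := Nat.lt_succ_iff_lt_or_eq.1 hr
        exacts [ht r hr', hle]
    · refine ⟨fun h => absurd (fun r hr => h r (by omega)) ht, fun _ => ?_⟩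
      rw [ih.2 ht, iterate_fTilde_none]

lemma isStaircase_highestWord (e m : ℕ) :
    IsStaircase (e * m) m 0 (e + 1) (highestWord (List.replicate (e + 1) m)) := by
  have hsum : (List.replicate (e + 1) m).sum = e * m + m := by
    simp [Nat.succ_mul]
  have hfilter (j : ℕ) (hj : j ≤ e * m + m) :
      (List.range (e + 1)).filter (fun r => shapePrefix (List.replicate (e + 1) m) (r + 1) < j) =
        (List.range e).filter (fun r => (r + 1) * m < j) := by
    rw [List.range_succ, List.filter_append]
    have hlast : ¬ (e + 1) * m < j := by rw [Nat.succ_mul]; omega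
    have hpre : shapePrefix (List.replicate (e + 1) m) (e + 1) = (e + 1) * m := by
      simp [shapePrefix]
    simp only [List.filter_cons, List.filter_nil, hpre, hlast, decide_false,
      Bool.false_eq_true, if_false, List.append_nil]
    refine List.filter_congr fun r hr => ?_
    have hr' : r + 1 ≤ e + 1 := by have := List.mem_range.1 hr; omega
    simp [shapePrefix, List.take_replicate, Nat.min_eq_left hr']
  intro j
  refine ⟨fun _ _ => by omega, fun h₁ h₂ => ?_, fun h => ?_⟩
  · rw [highestWord, if_pos (by omega), List.length_replicate, hfilter j h₂,
      List.filter_eq_self.2, List.length_range]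
    intro r hr
    have : (r + 1) * m ≤ e * m := Nat.mul_le_mul_right m (List.mem_range.1 hr)
    simp only [decide_eq_true_eq]
    omega
  · rw [highestWord]
    split_ifs with hj
    · have hj' : j ≤ e * m := by omega
      rw [List.length_replicate, hfilter j (by omega)]
      obtain ⟨e, rfl⟩ : ∃ e', e = e' + 1 :=
        Nat.exists_eq_succ_of_ne_zero (by rintro rfl; omega)
      refine Nat.succ_lt_succ (lt_of_lt_of_eq
        (List.length_filter_lt_length_iff_exists.2 ⟨e, by simp, ?_⟩) List.length_range)
      simpa using hj'
    · omega

/-- Lemma `zero` (1):  for the rectangular shape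
`λ = (m^a)` (`1 ≤ a ≤ k - 1`), `a ≤ a' ≤ k - 1` and nonnegative integers
`c_a, …, c_{a'}`, the tableau `f̃_{a'}^{c_{a'}} ⋯ f̃_a^{c_a}(T_λ)` is nonzero
if and only if `m ≥ c_a ≥ c_{a+1} ≥ ⋯ ≥ c_{a'} ≥ 0`. -/
theorem chain_on_highest_weight_tableau_ne_zero_iff
    (k a m a' : ℕ) (hk : 2 ≤ k) (ha : 1 ≤ a) (hak : a ≤ k - 1) (hm : 1 ≤ m)
    (haa' : a ≤ a') (ha'k : a' ≤ k - 1) (c : ℕ → ℕ) :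
    chainPow (a * m) c a a' (some (highestWord (List.replicate a m))) ≠ none ↔
      (c a ≤ m ∧ ∀ i, a ≤ i → i < a' → c (i + 1) ≤ c i) := by
  obtain ⟨e, rfl⟩ : ∃ e, a = e + 1 := ⟨a - 1, by omega⟩
  let b : ℕ → ℕ := fun r => Nat.casesOn r m fun s => c (e + 1 + s)
  have hmain := foldl_iterate_fTilde (n := (e + 1) * m) b (isStaircase_highestWord e m)
    (Nat.succ_mul e m).ge (a' + 1 - (e + 1))
  have hcond : (∀ r < a' + 1 - (e + 1), b (r + 1) ≤ b r) ↔
      (c (e + 1) ≤ m ∧ ∀ i, e + 1 ≤ i → i < a' → c (i + 1) ≤ c i) := by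
    constructor
    · refine fun h => ⟨h 0 (by omega), fun i hi hi' => ?_⟩
      obtain ⟨s, rfl⟩ := Nat.exists_eq_add_of_le hi
      exact h (s + 1) (by omega)
    · rintro ⟨h₀, h⟩ (_ | s) hr
      · exact h₀
      · exact h (e + 1 + s) (by omega) (by omega)
  rw [← hcond]
  constructor
  · exact fun h => not_not.1 fun hn => h (hmain.2 hn)
  · intro h
    obtain ⟨-, w, hw, -⟩ := hmain.1 h
    exact fun hnone => Option.some_ne_none w (hw.symm.trans hnone)

end CST
end

section
/- Let k ≥ 3, 2 ≤ a ≤ k−1, m ≥ 1, and let λ = (m^a) be the rectangular partition with a rows of length m. For all 0 ≤ j ≤ m: f̃_{a−1}^j f̃_a^j(T_λ) ≠ 0, and f̃_{a−1}^{j+1} f̃_a^j(T_λ) = 0. -/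
/-!
Semistandard Young tableaux are encoded by their "reading words"
`w : ℕ → ℕ`:  the boxes of the shape `μ` are labelled `1, …, |μ|`, the boxes
of row `i` (`i = 1, 2, …`) receiving the labels
`μ₁ + ⋯ + μ_{i-1} + 1, …, μ₁ + ⋯ + μ_i`, increasing from right to left within
each row, and `w j` is the entry of the box labelled `j` (with `w j = 0`
outside the labels `1, …, |μ|`).  A vanished tableau (`0`) is represented by
`none : Option (ℕ → ℕ)`.
-/

namespace CST

theorem foldl_scanStep_eq_append (i : ℕ) (w : ℕ → ℕ) (l acc : List ℕ) (h : ∀ x ∈ l, w x = i) :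
    l.foldl (scanStep i w) acc = l.reverse ++ acc := by
  induction l generalizing acc with
  | nil => rfl
  | cons y l ih => simp_all [scanStep]

theorem foldl_scanStep_eq_drop (i : ℕ) (w : ℕ → ℕ) (l acc : List ℕ)
    (h : ∀ x ∈ l, w x = i + 1) :
    l.foldl (scanStep i w) acc = acc.drop l.length := by
  induction l generalizing acc with
  | nil => rfl
  | cons y l ih => simp_all [scanStep]

theorem foldl_scanStep_eq_self (i : ℕ) (w : ℕ → ℕ) (l acc : List ℕ)
    (h : ∀ x ∈ l, w x ≠ i ∧ w x ≠ i + 1) :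
    l.foldl (scanStep i w) acc = acc := by
  induction l generalizing acc with
  | nil => rfl
  | cons y l ih => simp_all [scanStep]

theorem foldl_scanStep_nil (i : ℕ) (w : ℕ → ℕ) (l : List ℕ) (h : ∀ x ∈ l, w x ≠ i) :
    l.foldl (scanStep i w) [] = [] := by
  induction l with
  | nil => rfl
  | cons y l ih => simp_all [scanStep]

/-- The labels `1, …, n` of `w` split at `p ≤ q ≤ r ≤ n` into a block without `i`, a block of
letters `i`, a block avoiding `i` and `i + 1`, and a block of letters `i + 1`. -/
structure IsBlockWord (n i p q r : ℕ) (w : ℕ → ℕ) : Prop where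
  le_left : p ≤ q
  le_mid : q ≤ r
  le_right : r ≤ n
  ne_of_le : ∀ x, 1 ≤ x → x ≤ p → w x ≠ i
  eq_of_le : ∀ x, p < x → x ≤ q → w x = i
  avoid_of_le : ∀ x, q < x → x ≤ r → w x ≠ i ∧ w x ≠ i + 1
  eq_succ_of_le : ∀ x, r < x → x ≤ n → w x = i + 1

namespace IsBlockWord

variable {n i p q r : ℕ} {w : ℕ → ℕ}

theorem unmatched_eq (h : IsBlockWord n i p q r w) :
    unmatched n i w = (List.range' (p + 1) ((q - p) - (n - r))).reverse := by
  obtain ⟨hpq, hqr, hrn, h₁, h₂, h₃, h₄⟩ := h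
  have hsplit : (List.range n).map (· + 1) = List.range' 1 p ++ List.range' (p + 1) (q - p) ++
      List.range' (q + 1) (r - q) ++ List.range' (r + 1) (n - r) := by
    obtain ⟨b, rfl⟩ := Nat.exists_eq_add_of_le hpq
    obtain ⟨c, rfl⟩ := Nat.exists_eq_add_of_le hqr
    obtain ⟨d, rfl⟩ := Nat.exists_eq_add_of_le hrn
    simp only [Nat.add_sub_cancel_left, Nat.add_comm _ 1, ← List.range'_eq_map_range,
      List.range'_append_1]
  rw [unmatched, hsplit, List.foldl_append, List.foldl_append, List.foldl_append,
    foldl_scanStep_nil i w (List.range' 1 p),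
    foldl_scanStep_eq_append i w (List.range' (p + 1) (q - p)),
    foldl_scanStep_eq_self i w (List.range' (q + 1) (r - q)),
    foldl_scanStep_eq_drop i w (List.range' (r + 1) (n - r))]
  · simp [List.drop_reverse]
  all_goals
    intro x hx
    rw [List.mem_range'_1] at hx
  · exact h₄ x (by omega) (by omega)
  · exact h₃ x (by omega) (by omega)
  · exact h₂ x (by omega) (by omega)
  · exact h₁ x (by omega) (by omega)

theorem fTilde_eq_none (h : IsBlockWord n i p q r w) (hd : q - p ≤ n - r) :
    fTilde n i (some w) = none := by
  simp [fTilde, h.unmatched_eq, Nat.sub_eq_zero_of_le hd]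

theorem fTilde_eq_update (h : IsBlockWord n i p q r w) (hd : n - r < q - p) :
    fTilde n i (some w) = some (Function.update w (p + 1) (i + 1)) := by
  have hmin : (unmatched n i w).min? = some (p + 1) := by
    rw [h.unmatched_eq, List.min?_eq_some_iff]
    simp only [List.mem_reverse, List.mem_range'_1]
    exact ⟨by omega, fun b hb => hb.1⟩
  simp [fTilde, hmin]

/-- Raising the first `t` letters of the block of `i`s yields a block word again. -/
theorem raise (h : IsBlockWord n i p q r w) {t : ℕ} (ht : t ≤ q - p) :
    IsBlockWord n i (p + t) q r (fun x => if p < x ∧ x ≤ p + t then i + 1 else w x) := by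
  obtain ⟨hpq, hqr, hrn, h₁, h₂, h₃, h₄⟩ := h
  refine ⟨by omega, hqr, hrn, fun x hx hxp => ?_, fun x hx hxq => ?_, fun x hx hxr => ?_,
    fun x hx hxn => ?_⟩
  · split_ifs
    · omega
    · exact h₁ x hx (by omega)
  · rw [if_neg (by omega)]
    exact h₂ x (by omega) hxq
  · rw [if_neg (by omega)]
    exact h₃ x hx hxr
  · rw [if_neg (by omega)]
    exact h₄ x hx hxn

theorem iterate_fTilde (h : IsBlockWord n i p q r w) {t : ℕ} (ht : t ≤ (q - p) - (n - r)) :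
    (fTilde n i)^[t] (some w) =
      some (fun x => if p < x ∧ x ≤ p + t then i + 1 else w x) := by
  induction t with
  | zero =>
    simp only [Function.iterate_zero, id, Option.some.injEq]
    ext x
    rw [if_neg (by omega)]
  | succ t ih =>
    rw [Function.iterate_succ_apply', ih (by omega),
      (h.raise (by omega : t ≤ q - p)).fTilde_eq_update (by omega)]
    congr 1
    ext x
    simp only [Function.update_apply]
    split_ifs <;> first | rfl | omega

theorem iterate_fTilde_eq_none (h : IsBlockWord n i p q r w) :
    (fTilde n i)^[(q - p) - (n - r) + 1] (some w) = none := by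
  rw [Function.iterate_succ_apply', h.iterate_fTilde le_rfl]
  exact (h.raise (Nat.sub_le _ _)).fTilde_eq_none (by omega)

end IsBlockWord

theorem highestWord_replicate_s3 {a m r x : ℕ} (hr : r < a) (h₁ : r * m < x)
    (h₂ : x ≤ (r + 1) * m) : highestWord (List.replicate a m) x = r + 1 := by
  have hle : (r + 1) * m ≤ a * m := Nat.mul_le_mul_right m hr
  have hfilter : (List.range a).filter
      (fun s => shapePrefix (List.replicate a m) (s + 1) < x) = List.range r := by
    obtain ⟨b, rfl⟩ := Nat.exists_eq_add_of_le hr.le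
    rw [List.range_add, List.filter_append, List.filter_eq_self.mpr, List.filter_eq_nil_iff.mpr,
      List.append_nil]
    · intro s hs
      obtain ⟨c, hc, rfl⟩ := List.mem_map.mp hs
      have hcb := List.mem_range.mp hc
      have : (r + 1) * m ≤ (r + c + 1) * m := Nat.mul_le_mul_right m (by omega)
      simp only [shapePrefix, List.take_replicate, List.sum_replicate, smul_eq_mul,
        decide_eq_true_eq]
      rw [min_eq_left (by omega)]
      omega
    · intro s hs
      have hsr := List.mem_range.mp hs
      have : (s + 1) * m ≤ r * m := Nat.mul_le_mul_right m hsr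
      simp only [shapePrefix, List.take_replicate, List.sum_replicate, smul_eq_mul,
        decide_eq_true_eq]
      rw [min_eq_left (by omega)]
      omega
  simp only [highestWord, List.length_replicate, List.sum_replicate, smul_eq_mul, hfilter,
    List.length_range]
  rw [if_pos (by omega)]

theorem highestWord_replicate_le {a m r x : ℕ} (hr : r ≤ a) (hx : 1 ≤ x) (h : x ≤ r * m) :
    highestWord (List.replicate a m) x ≤ r := by
  have hm : 0 < m := Nat.pos_of_mul_pos_left (by omega : 0 < r * m)
  have hlt : (x - 1) / m < r := (Nat.div_lt_iff_lt_mul hm).mpr (by omega)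
  have hlow := Nat.div_mul_le_self (x - 1) m
  have hupp := Nat.lt_div_mul_add (a := x - 1) hm
  rw [← Nat.add_one_mul] at hupp
  rw [highestWord_replicate_s3 (r := (x - 1) / m) (by omega) (by omega) (by omega)]
  exact hlt

/-- Lemma `zero` (3):  for the rectangular shape
`λ = (m^a)` (`2 ≤ a ≤ k - 1`) and `0 ≤ j ≤ m`,
`f̃_{a-1}^j f̃_a^j (T_λ) ≠ 0` and `f̃_{a-1}^{j+1} f̃_a^j (T_λ) = 0`. -/
theorem lowering_a_minus_one_bound
    (k a m j : ℕ) (hk : 3 ≤ k) (ha : 2 ≤ a) (hak : a ≤ k - 1) (hm : 1 ≤ m)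
    (hj : j ≤ m) :
    (fTilde (a * m) (a - 1))^[j]
        ((fTilde (a * m) a)^[j] (some (highestWord (List.replicate a m)))) ≠ none ∧
    (fTilde (a * m) (a - 1))^[j + 1]
        ((fTilde (a * m) a)^[j] (some (highestWord (List.replicate a m)))) = none := by
  obtain ⟨b, rfl⟩ := Nat.exists_eq_add_of_le' ha
  rw [show b + 2 - 1 = b + 1 from rfl]
  have hB : (b + 1) * m = b * m + m := Nat.succ_mul b m
  have hA : (b + 2) * m = b * m + m + m := by ring
  have hrow : IsBlockWord ((b + 2) * m) (b + 2) ((b + 1) * m) ((b + 2) * m) ((b + 2) * m)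
      (highestWord (List.replicate (b + 2) m)) := by
    refine ⟨by omega, le_rfl, le_rfl, fun x hx hxp => ?_, fun x hx hxq => ?_,
      fun x hx hxr => by omega, fun x hx hxn => by omega⟩
    · have := highestWord_replicate_le (a := b + 2) (by omega) hx hxp
      omega
    · exact highestWord_replicate_s3 (by omega) hx hxq
  rw [hrow.iterate_fTilde (by omega)]
  have hpair : IsBlockWord ((b + 2) * m) (b + 1) (b * m) ((b + 1) * m) ((b + 1) * m + j)
      (fun x => if (b + 1) * m < x ∧ x ≤ (b + 1) * m + j then b + 2 + 1
        else highestWord (List.replicate (b + 2) m) x) := by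
    refine ⟨by omega, by omega, by omega, fun x hx hxp => ?_, fun x hx hxq => ?_,
      fun x hx hxr => ?_, fun x hx hxn => ?_⟩
    · have := highestWord_replicate_le (a := b + 2) (by omega) hx hxp
      rw [if_neg (by omega)]
      omega
    · rw [if_neg (by omega)]
      exact highestWord_replicate_s3 (by omega) hx hxq
    · rw [if_pos ⟨hx, hxr⟩]
      omega
    · rw [if_neg (by omega)]
      exact highestWord_replicate_s3 (by omega) (by omega) hxn
  refine ⟨?_, ?_⟩
  · rw [hpair.iterate_fTilde (by omega)]
    exact Option.some_ne_none _
  · have hd : ((b + 1) * m - b * m) - ((b + 2) * m - ((b + 1) * m + j)) = j := by omega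
    simpa only [hd] using hpair.iterate_fTilde_eq_none

end CST
end

section
/- Let k ≥ 3, 1 ≤ a ≤ k−2, m ≥ 1, and let λ = (m^a) be the rectangular partition with a rows of length m. For all 0 ≤ j ≤ m: f̃_a^{m−j} f̃_{a+1}^j f̃_a^j(T_λ) ≠ 0, and f̃_a^{m−j+1} f̃_{a+1}^j f̃_a^j(T_λ) = 0. -/
/-!
Semistandard Young tableaux are encoded by their "reading words"
`w : ℕ → ℕ`:  the boxes of the shape `μ` are labelled `1, …, |μ|`, the boxes
of row `i` (`i = 1, 2, …`) receiving the labels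
`μ₁ + ⋯ + μ_{i-1} + 1, …, μ₁ + ⋯ + μ_i`, increasing from right to left within
each row, and `w j` is the entry of the box labelled `j` (with `w j = 0`
outside the labels `1, …, |μ|`).  A vanished tableau (`0`) is represented by
`none : Option (ℕ → ℕ)`.
-/

namespace CST

/-- In the labels `1, …, n` the letters `i` of `w` occupy exactly the interval `[s, e)`, and every
letter `i + 1` comes before `s`; hence no letter `i` is matched. -/
structure IsBlock (n i s e : ℕ) (w : ℕ → ℕ) : Prop where
  one_le : 1 ≤ s
  le_succ : e ≤ n + 1
  eq_iff : ∀ l, 1 ≤ l → l ≤ n → (w l = i ↔ s ≤ l ∧ l < e)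
  lt_of_eq : ∀ l, 1 ≤ l → l ≤ n → w l = i + 1 → l < s

theorem unmatched_succ (q i : ℕ) (w : ℕ → ℕ) :
    unmatched (q + 1) i w = scanStep i w (unmatched q i w) (q + 1) := by
  simp [unmatched, List.range_succ]

theorem IsBlock.mem_unmatched {n i s e : ℕ} {w : ℕ → ℕ} (h : IsBlock n i s e w) :
    ∀ q ≤ n, ∀ l, l ∈ unmatched q i w ↔ s ≤ l ∧ l < e ∧ l ≤ q := by
  intro q
  induction q with
  | zero =>
    intro _ l
    have := h.one_le
    simp only [unmatched, List.range_zero, List.map_nil, List.foldl_nil, List.not_mem_nil,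
      false_iff]
    omega
  | succ q ih =>
    intro hq l
    have ih := ih (by omega)
    have hi := h.eq_iff (q + 1) (by omega) hq
    rw [unmatched_succ, scanStep]
    split_ifs with h1 h2
    · rw [List.mem_cons, ih]
      have := hi.1 h1
      omega
    · have hs := h.lt_of_eq (q + 1) (by omega) hq h2
      have hnil : unmatched q i w = [] := by
        rw [List.eq_nil_iff_forall_not_mem]
        intro x hx
        have := (ih x).1 hx
        omega
      simp only [hnil, List.drop_nil, List.not_mem_nil, false_iff]
      omega
    · rw [ih]
      have : ¬ (s ≤ q + 1 ∧ q + 1 < e) := fun hc => h1 (hi.2 hc)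
      constructor
      · omega
      · rintro ⟨h3, h4, h5⟩
        refine ⟨h3, h4, ?_⟩
        by_contra hlt
        obtain rfl : l = q + 1 := by omega
        exact this ⟨h3, h4⟩

theorem IsBlock.fTilde_eq_some {n i s e : ℕ} {w : ℕ → ℕ} (h : IsBlock n i s e w) (hse : s < e) :
    fTilde n i (some w) = some (Function.update w s (i + 1)) := by
  have hle := h.le_succ
  have hmin : (unmatched n i w).min? = some s := by
    rw [List.min?_eq_some_iff]
    refine ⟨(h.mem_unmatched n le_rfl s).2 ⟨le_rfl, hse, by omega⟩, fun b hb => ?_⟩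
    exact ((h.mem_unmatched n le_rfl b).1 hb).1
  simp [fTilde, hmin]

theorem IsBlock.fTilde_eq_none {n i s e : ℕ} {w : ℕ → ℕ} (h : IsBlock n i s e w) (hes : e ≤ s) :
    fTilde n i (some w) = none := by
  have hnil : unmatched n i w = [] := by
    rw [List.eq_nil_iff_forall_not_mem]
    intro x hx
    have := (h.mem_unmatched n le_rfl x).1 hx
    omega
  simp [fTilde, hnil]

theorem IsBlock.update {n i s e : ℕ} {w : ℕ → ℕ} (h : IsBlock n i s e w) :
    IsBlock n i (s + 1) e (Function.update w s (i + 1)) where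
  one_le := by omega
  le_succ := h.le_succ
  eq_iff l h1 h2 := by
    have := h.eq_iff l h1 h2
    rcases eq_or_ne l s with rfl | hne
    · simp
    · rw [Function.update_of_ne hne]
      omega
  lt_of_eq l h1 h2 := by
    have := h.lt_of_eq l h1 h2
    rcases eq_or_ne l s with rfl | hne
    · simp
    · rw [Function.update_of_ne hne]
      omega

/-- Iterating the lowering operator on a block raises its first `t` letters and leaves a shorter
block. -/
theorem IsBlock.iterate {n i e : ℕ} (t : ℕ) {s : ℕ} {w : ℕ → ℕ} (h : IsBlock n i s e w)
    (hte : s + t ≤ e) :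
    ∃ w', (fTilde n i)^[t] (some w) = some w' ∧ IsBlock n i (s + t) e w' ∧
      ∀ l, w' l = if s ≤ l ∧ l < s + t then i + 1 else w l := by
  induction t generalizing s w with
  | zero =>
    refine ⟨w, rfl, h, fun l => ?_⟩
    rw [if_neg (by omega)]
  | succ t ih =>
    obtain ⟨w', h1, h2, h3⟩ := ih h.update (by omega)
    refine ⟨w', ?_, ?_, fun l => ?_⟩
    · rw [Function.iterate_succ_apply, h.fTilde_eq_some (by omega), h1]
    · rwa [show s + (t + 1) = s + 1 + t by omega]
    · rw [h3, Function.update_apply]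
      split_ifs <;> first | rfl | omega

theorem highestWord_replicate_s4 {b m l : ℕ} (h1 : 1 ≤ l) (hl : l ≤ (b + 1) * m) :
    highestWord (List.replicate (b + 1) m) l ≤ b + 1 ∧
      (highestWord (List.replicate (b + 1) m) l = b + 1 ↔ b * m < l) := by
  have hlast : ¬ shapePrefix (List.replicate (b + 1) m) (b + 1) < l := by
    simpa [shapePrefix] using hl
  have hw : highestWord (List.replicate (b + 1) m) l =
      ((List.range b).filter fun r =>
        shapePrefix (List.replicate (b + 1) m) (r + 1) < l).length + 1 := by
    rw [highestWord, if_pos ⟨h1, by simpa using hl⟩, List.length_replicate, List.range_succ,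
      List.filter_append]
    simp [hlast]
  have hle := List.length_filter_le
    (fun r => decide (shapePrefix (List.replicate (b + 1) m) (r + 1) < l)) (List.range b)
  rw [List.length_range] at hle
  rw [hw]
  refine ⟨by omega, ?_⟩
  have hall := List.length_filter_eq_length_iff (l := List.range b)
    (p := fun r => decide (shapePrefix (List.replicate (b + 1) m) (r + 1) < l))
  rw [List.length_range] at hall
  rw [Nat.add_right_cancel_iff, hall]
  simp only [List.mem_range, decide_eq_true_eq, shapePrefix, List.take_replicate,
    List.sum_replicate, smul_eq_mul]
  constructor
  · intro h
    rcases b with _ | b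
    · omega
    · simpa using h b (by omega)
  · intro h r hr
    rw [min_eq_left (by omega)]
    exact (Nat.mul_le_mul_right m hr).trans_lt h

/-- Lemma `zero` (4):  for the rectangular shape
`λ = (m^a)` (`1 ≤ a ≤ k - 2`) and `0 ≤ j ≤ m`,
`f̃_a^{m-j} f̃_{a+1}^j f̃_a^j (T_λ) ≠ 0` and
`f̃_a^{m-j+1} f̃_{a+1}^j f̃_a^j (T_λ) = 0`. -/
theorem lowering_a_again_bound
    (k a m j : ℕ) (hk : 3 ≤ k) (ha : 1 ≤ a) (hak : a ≤ k - 2) (hm : 1 ≤ m)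
    (hj : j ≤ m) :
    (fTilde (a * m) a)^[m - j]
        ((fTilde (a * m) (a + 1))^[j]
          ((fTilde (a * m) a)^[j] (some (highestWord (List.replicate a m))))) ≠ none ∧
    (fTilde (a * m) a)^[m - j + 1]
        ((fTilde (a * m) (a + 1))^[j]
          ((fTilde (a * m) a)^[j] (some (highestWord (List.replicate a m))))) = none := by
  obtain ⟨b, rfl⟩ : ∃ b, a = b + 1 := ⟨a - 1, by omega⟩
  have hn : (b + 1) * m = b * m + m := by ring
  have hT : ∀ l, 1 ≤ l → l ≤ (b + 1) * m → _ := fun l h1 h2 =>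
    highestWord_replicate_s4 (b := b) (m := m) h1 h2
  generalize highestWord (List.replicate (b + 1) m) = w₀ at hT ⊢
  generalize (b + 1) * m = n at hn hT ⊢
  generalize b * m = p at hn hT
  have hB₀ : IsBlock n (b + 1) (p + 1) (n + 1) w₀ :=
    ⟨by omega, le_rfl, fun l h1 h2 => by have := hT l h1 h2; omega,
      fun l h1 h2 => by have := hT l h1 h2; omega⟩
  obtain ⟨w₁, hw₁, -, hv₁⟩ := hB₀.iterate j (by omega)
  have hB₁ : IsBlock n (b + 1 + 1) (p + 1) (p + 1 + j) w₁ := by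
    refine ⟨by omega, by omega, fun l h1 h2 => ?_, fun l h1 h2 => ?_⟩ <;>
    · have := hT l h1 h2
      rw [hv₁]
      split_ifs <;> omega
  obtain ⟨w₂, hw₂, -, hv₂⟩ := hB₁.iterate j le_rfl
  have hB₂ : IsBlock n (b + 1) (p + 1 + j) (n + 1) w₂ := by
    refine ⟨by omega, le_rfl, fun l h1 h2 => ?_, fun l h1 h2 => ?_⟩ <;>
    · have := hT l h1 h2
      rw [hv₂, hv₁]
      split_ifs <;> omega
  obtain ⟨w₃, hw₃, hB₃, -⟩ := hB₂.iterate (m - j) (by omega)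
  rw [hw₁, hw₂, Function.iterate_succ_apply', hw₃]
  exact ⟨by simp, hB₃.fTilde_eq_none (by omega)⟩

end CST
end

section
/- Let k ≥ 2, 1 ≤ a ≤ k−1, m ≥ 1, and let V^λ be an irreducible highest weight U_q(sl_k)-module with highest weight λ = mω_a and highest weight vector v_λ. For all a ≤ a′ ≤ k−1 and all nonnegative integers c_a, c_{a+1}, …, c_{a′}, the vector f_{a′}^{(c_{a′})} ⋯ f_{a+1}^{(c_{a+1})} f_a^{(c_a)} v_λ is nonzero if and only if m ≥ c_a ≥ c_{a+1} ≥ ⋯ ≥ c_{a′} ≥ 0. -/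
/-!
Common setup: the quantum group `U_q(sl_k)` (presented by generators
`e_i, f_i, K_i = q^{h_i}, K_i⁻¹` for `1 ≤ i ≤ k-1` and the standard relations)
over the field `KK = ℚ(q)`, and the notion of an irreducible highest weight
module.  Weights are recorded as functions `μ : ℕ → ℤ`, `μ i` being the value
`μ(h_i)` on the `i`-th simple coroot.
-/

noncomputable section
namespace QSL

abbrev KK : Type := RatFunc ℚ

/-- the variable `q`. -/
def qv : KK := RatFunc.X

/-- the quantum integer `[n]_q = (qⁿ - q⁻ⁿ)/(q - q⁻¹)`. -/
def qInt (n : ℕ) : KK := (qv ^ n - qv⁻¹ ^ n) / (qv - qv⁻¹)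

/-- the quantum factorial `[n]_q!`. -/
def qFact : ℕ → KK
  | 0 => 1
  | n + 1 => qFact n * qInt (n + 1)

/-- the Gaussian binomial coefficient `[m choose j]_q`. -/
def qBinom (m j : ℕ) : KK :=
  (∏ t ∈ Finset.range j, qInt (m - t)) / (∏ t ∈ Finset.range j, qInt (j - t))

/-- the Cartan matrix of `sl`:  `cartan i j = αⱼ(h_i)`. -/
def cartan (i j : ℕ) : ℤ := if i = j then 2 else if i + 1 = j ∨ j + 1 = i then -1 else 0

/-- The quantum group with `d` nodes (`d = k - 1` for `U_q(sl_k)`): a unital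
associative `ℚ(q)`-algebra generated by elements `e i, f i, K i, Kinv i`
(`1 ≤ i ≤ d`, where `K i = q^{h_i}`) subject to the standard relations. -/
structure QGroup (d : ℕ) where
  U : Type
  [ring : Ring U]
  [alg : Algebra KK U]
  e : ℕ → U
  f : ℕ → U
  K : ℕ → U
  Kinv : ℕ → U
  K_mul_Kinv : ∀ i, 1 ≤ i → i ≤ d → K i * Kinv i = 1
  Kinv_mul_K : ∀ i, 1 ≤ i → i ≤ d → Kinv i * K i = 1
  K_comm : ∀ i j, 1 ≤ i → i ≤ d → 1 ≤ j → j ≤ d → K i * K j = K j * K i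
  K_e_Kinv : ∀ i j, 1 ≤ i → i ≤ d → 1 ≤ j → j ≤ d →
      K i * e j * Kinv i = (qv ^ cartan i j) • e j
  K_f_Kinv : ∀ i j, 1 ≤ i → i ≤ d → 1 ≤ j → j ≤ d →
      K i * f j * Kinv i = (qv ^ (-cartan i j)) • f j
  e_f_comm : ∀ i j, 1 ≤ i → i ≤ d → 1 ≤ j → j ≤ d →
      e i * f j - f j * e i = if i = j then (qv - qv⁻¹)⁻¹ • (K i - Kinv i) else 0
  serre_e : ∀ i j, 1 ≤ i → i ≤ d → 1 ≤ j → j ≤ d → (i + 1 = j ∨ j + 1 = i) →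
      e i * e i * e j - (qv + qv⁻¹) • (e i * e j * e i) + e j * e i * e i = 0
  serre_f : ∀ i j, 1 ≤ i → i ≤ d → 1 ≤ j → j ≤ d → (i + 1 = j ∨ j + 1 = i) →
      f i * f i * f j - (qv + qv⁻¹) • (f i * f j * f i) + f j * f i * f i = 0
  comm_e : ∀ i j, 1 ≤ i → i ≤ d → 1 ≤ j → j ≤ d → (i + 1 < j ∨ j + 1 < i) →
      e i * e j = e j * e i
  comm_f : ∀ i j, 1 ≤ i → i ≤ d → 1 ≤ j → j ≤ d → (i + 1 < j ∨ j + 1 < i) →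
      f i * f j = f j * f i
  gen : ∀ x : U, x ∈ Algebra.adjoin KK
      {y : U | ∃ i, 1 ≤ i ∧ i ≤ d ∧ (y = e i ∨ y = f i ∨ y = K i ∨ y = Kinv i)}

attribute [instance] QGroup.ring QGroup.alg

variable {d : ℕ} (G : QGroup d)

/-- the divided power `f_i^{(n)} = f_iⁿ/[n]_q!`. -/
def fDiv (i n : ℕ) : G.U := (qFact n)⁻¹ • (G.f i) ^ n

/-- the divided power `e_i^{(n)} = e_iⁿ/[n]_q!`. -/
def eDiv (i n : ℕ) : G.U := (qFact n)⁻¹ • (G.e i) ^ n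

variable {V : Type} [AddCommGroup V] [Module KK V] [Module G.U V] [IsScalarTower KK G.U V]

/-- `u` is a weight vector of weight `μ` (recorded via `μ i = μ(h_i)`). -/
def IsWtVec (u : V) (μ : ℕ → ℤ) : Prop :=
  ∀ i, 1 ≤ i → i ≤ d → G.K i • u = (qv ^ μ i) • u

/-- `V` is an irreducible highest weight module over `G` with highest weight
`lam` and highest weight vector `v`: it is finite dimensional over `ℚ(q)`,
has a weight space decomposition, `v` is a nonzero weight vector of weight
`lam` annihilated by the `e_i`, `V` is generated by `v`, and `V` is
irreducible. -/
structure IsHWModule (lam : ℕ → ℤ) (v : V) : Prop where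
  findim : FiniteDimensional KK V
  ne_zero : v ≠ 0
  wt : IsWtVec G v lam
  hw : ∀ i, 1 ≤ i → i ≤ d → G.e i • v = 0
  gen : ∀ w : V, ∃ p : G.U, p • v = w
  irred : ∀ W : Submodule G.U V, W = ⊥ ∨ W = ⊤
  decomp : Submodule.span KK {u : V | ∃ μ : ℕ → ℤ, IsWtVec G u μ} = ⊤

/-- the weight `m ω_a`. -/
def omWt (a m : ℕ) : ℕ → ℤ := fun i => if i = a then (m : ℤ) else 0

/-- the weight `j ω_{a-1} + (m - j) ω_a`. -/
def hookWt (a m j : ℕ) : ℕ → ℤ := fun i =>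
  (if i = a - 1 then (j : ℤ) else 0) + (if i = a then (m : ℤ) - (j : ℤ) else 0)

/-- `f_{a'}^{(c_{a'})} ⋯ f_{a+1}^{(c_{a+1})} f_a^{(c_a)} • v`. -/
def fDivChain (c : ℕ → ℕ) (a a' : ℕ) (v : V) : V :=
  (List.range (a' + 1 - a)).foldl (fun u r => fDiv G (a + r) (c (a + r)) • u) v

theorem qv_ne_zero : qv ≠ 0 := RatFunc.X_ne_zero

theorem qv_pow_eq_one {n : ℕ} (h : qv ^ n = 1) : n = 0 := by
  have h1 : algebraMap (Polynomial ℚ) KK (Polynomial.X ^ n) = algebraMap (Polynomial ℚ) KK 1 := by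
    simpa [qv] using h
  have h2 := congrArg Polynomial.natDegree (RatFunc.algebraMap_injective ℚ h1)
  simpa using h2

theorem qv_zpow_eq_one {n : ℤ} (h : qv ^ n = 1) : n = 0 := by
  obtain ⟨s, rfl | rfl⟩ := n.eq_nat_or_neg
  · simpa using qv_pow_eq_one (by simpa using h)
  · simpa using qv_pow_eq_one (by simpa using h)

theorem qv_zpow_injective : Function.Injective fun n : ℤ => qv ^ n := by
  intro i j h
  have : qv ^ (i - j) = 1 := by
    rw [zpow_sub₀ qv_ne_zero]
    exact (div_eq_one_iff_eq (zpow_ne_zero _ qv_ne_zero)).2 h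
  have := qv_zpow_eq_one this
  omega

theorem qv_sub_inv_ne_zero : qv - qv⁻¹ ≠ 0 := by
  intro h
  have : (1 : ℤ) = -1 := qv_zpow_injective (by simpa [sub_eq_zero] using h)
  omega

/-- The quantum integer `[n]_q` for an integer `n`. -/
def qIntZ (n : ℤ) : KK := (qv - qv⁻¹)⁻¹ * (qv ^ n - qv ^ (-n))

theorem qIntZ_ne_zero {n : ℤ} (hn : n ≠ 0) : qIntZ n ≠ 0 := by
  refine mul_ne_zero (inv_ne_zero qv_sub_inv_ne_zero) fun h => hn ?_
  have : n = -n := qv_zpow_injective (sub_eq_zero.1 h)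
  omega

theorem qInt_eq_qIntZ (n : ℕ) : qInt n = qIntZ n := by
  simp [qInt, qIntZ, div_eq_inv_mul]

theorem qFact_ne_zero (n : ℕ) : qFact n ≠ 0 := by
  induction n with
  | zero => simp [qFact]
  | succ n ih =>
    rw [qFact, qInt_eq_qIntZ]
    exact mul_ne_zero ih (qIntZ_ne_zero (by omega))

theorem qIntZ_mul_add (n s : ℤ) :
    qIntZ s * qIntZ (n - s + 1) + qIntZ (n - 2 * s) = qIntZ (s + 1) * qIntZ (n - s) := by
  have h0 := qv_ne_zero
  have h1 : qv ^ 2 - 1 ≠ 0 := by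
    intro h
    have := qv_pow_eq_one (sub_eq_zero.1 h)
    omega
  have hn : qv ^ n ≠ 0 := zpow_ne_zero _ h0
  have hs : qv ^ s ≠ 0 := zpow_ne_zero _ h0
  simp only [qIntZ, neg_add, neg_sub, two_mul, zpow_add₀ h0, zpow_sub₀ h0, zpow_neg, zpow_one]
  have h2 := qv_sub_inv_ne_zero
  field_simp
  ring

theorem K_smul_f_pow_smul {i j : ℕ} (hi : 1 ≤ i) (hid : i ≤ d) (hj : 1 ≤ j) (hjd : j ≤ d)
    {u : V} {n : ℤ} (hu : G.K j • u = (qv ^ n) • u) (s : ℕ) :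
    G.K j • (G.f i ^ s • u) = (qv ^ (n - s * cartan j i)) • (G.f i ^ s • u) := by
  induction s with
  | zero => simpa using hu
  | succ s ih =>
    have hKf : G.K j * G.f i = (qv ^ (-cartan j i)) • (G.f i * G.K j) := by
      rw [← smul_mul_assoc, ← G.K_f_Kinv j i hj hjd hi hid, mul_assoc _ _ (G.K j),
        G.Kinv_mul_K j hj hjd, mul_one]
    rw [pow_succ', mul_smul, ← mul_smul, hKf, smul_assoc, mul_smul, ih, smul_comm (G.f i),
      smul_smul, ← zpow_add₀ qv_ne_zero]
    congr 2
    push_cast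
    ring

theorem Kinv_smul_of_K_smul {i : ℕ} (hi : 1 ≤ i) (hid : i ≤ d)
    {u : V} {n : ℤ} (hu : G.K i • u = (qv ^ n) • u) :
    G.Kinv i • u = (qv ^ (-n)) • u := by
  have h : u = (qv ^ n) • (G.Kinv i • u) := by
    rw [smul_comm, ← hu, ← mul_smul, G.Kinv_mul_K i hi hid, one_smul]
  conv_rhs => rw [h]
  rw [smul_smul, ← zpow_add₀ qv_ne_zero, neg_add_cancel, zpow_zero, one_smul]

theorem commute_e_f_pow_of_ne {i j : ℕ} (hi : 1 ≤ i) (hid : i ≤ d) (hj : 1 ≤ j) (hjd : j ≤ d)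
    (hij : j ≠ i) (s : ℕ) : Commute (G.e j) (G.f i ^ s) := by
  have h := G.e_f_comm j i hj hjd hi hid
  rw [if_neg hij, sub_eq_zero] at h
  exact Commute.pow_right h s

theorem e_smul_f_pow_succ_smul {i : ℕ} (hi : 1 ≤ i) (hid : i ≤ d)
    {u : V} {n : ℤ} (hK : G.K i • u = (qv ^ n) • u) (he : G.e i • u = 0) (s : ℕ) :
    G.e i • (G.f i ^ (s + 1) • u) = (qIntZ (s + 1) * qIntZ (n - s)) • (G.f i ^ s • u) := by
  have step (s : ℕ) : G.e i • (G.f i ^ (s + 1) • u) =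
      G.f i • (G.e i • (G.f i ^ s • u)) + qIntZ (n - 2 * s) • (G.f i ^ s • u) := by
    have hef : G.e i * G.f i = G.f i * G.e i + (qv - qv⁻¹)⁻¹ • (G.K i - G.Kinv i) := by
      have := G.e_f_comm i i hi hid hi hid
      rw [if_pos rfl] at this
      rw [← this]
      abel
    have hKs := K_smul_f_pow_smul G hi hid hi hid hK s
    rw [pow_succ', mul_smul, ← mul_smul, hef, add_smul, mul_smul, smul_assoc, sub_smul, hKs,
      Kinv_smul_of_K_smul G hi hid hKs, ← sub_smul, smul_smul (qv - qv⁻¹)⁻¹,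
      qIntZ]
    simp only [cartan, if_true, mul_comm (s : ℤ) 2]
  induction s with
  | zero =>
    have h1 : qIntZ 1 = 1 := by
      simp [qIntZ, inv_mul_cancel₀ qv_sub_inv_ne_zero]
    rw [step]
    simp [he, h1]
  | succ s ih =>
    rw [step, ih, smul_comm (G.f i), ← mul_smul, ← pow_succ', ← add_smul]
    have h := qIntZ_mul_add n (s + 1)
    rw [show n - (s + 1) + 1 = n - s by ring] at h
    push_cast
    rw [h]

theorem f_pow_smul_ne_zero {i : ℕ} (hi : 1 ≤ i) (hid : i ≤ d) {u : V} {n : ℤ}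
    (hK : G.K i • u = (qv ^ n) • u) (he : G.e i • u = 0) (hu : u ≠ 0) (s : ℕ)
    (hs : ∀ t : ℕ, t < s → n ≠ t) : G.f i ^ s • u ≠ 0 := by
  induction s with
  | zero => simpa using hu
  | succ s ih =>
    intro h
    have h1 := e_smul_f_pow_succ_smul G hi hid hK he s
    rw [h, smul_zero] at h1
    have hsn := hs s s.lt_succ_self
    exact smul_ne_zero (mul_ne_zero (qIntZ_ne_zero (by omega)) (qIntZ_ne_zero (by omega)))
      (ih fun t ht => hs t (by omega)) h1.symm

/-- In a finite-dimensional module a vector killed by `e_i` of negative `h_i`-weight vanishes. -/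
theorem eq_zero_of_e_smul_eq_zero_of_neg [FiniteDimensional KK V] {i : ℕ} (hi : 1 ≤ i)
    (hid : i ≤ d) {u : V} {n : ℤ} (hn : n < 0)
    (hK : G.K i • u = (qv ^ n) • u) (he : G.e i • u = 0) : u = 0 := by
  by_contra hu
  have hinj : Function.Injective fun s : ℕ => qv ^ (n - s * cartan i i) := by
    intro s t hst
    have := qv_zpow_injective hst
    simp only [cartan, if_true] at this
    omega
  have hli := Module.End.eigenvectors_linearIndependent' (Algebra.lsmul KK KK V (G.K i))
    (fun s : ℕ => qv ^ (n - s * cartan i i)) hinj (fun s => G.f i ^ s • u) fun s =>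
      Module.End.hasEigenvector_iff.2 ⟨Module.End.mem_eigenspace_iff.2
        (K_smul_f_pow_smul G hi hid hi hid hK s),
        f_pow_smul_ne_zero G hi hid hK he hu s fun t _ => by omega⟩
  have := hli.finite
  exact not_finite ℕ

theorem f_pow_smul_ne_zero_iff [FiniteDimensional KK V] {i : ℕ} (hi : 1 ≤ i) (hid : i ≤ d)
    {u : V} {n : ℕ} (hK : G.K i • u = (qv ^ (n : ℤ)) • u) (he : G.e i • u = 0) (s : ℕ) :
    G.f i ^ s • u ≠ 0 ↔ u ≠ 0 ∧ s ≤ n := by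
  constructor
  · refine fun h => ⟨fun hu => h (by simp [hu]), ?_⟩
    by_contra! hs
    apply h
    have hz : G.f i ^ (n + 1) • u = 0 := by
      refine eq_zero_of_e_smul_eq_zero_of_neg G hi hid (n := n - (n + 1 : ℕ) * cartan i i) ?_
        (K_smul_f_pow_smul G hi hid hi hid hK (n + 1)) ?_
      · simp only [cartan, if_true]
        omega
      · rw [e_smul_f_pow_succ_smul G hi hid hK he]
        simp [qIntZ]
    obtain ⟨r, rfl⟩ := Nat.exists_eq_add_of_le' (show n + 1 ≤ s from hs)
    rw [pow_add, mul_smul, hz, smul_zero]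
  · rintro ⟨hu, hs⟩
    exact f_pow_smul_ne_zero G hi hid hK he hu s fun t ht => by omega

/-- The `h_{a+n}`-weight of the chain of the first `n` divided powers. -/
def chainTop (c : ℕ → ℕ) (a m : ℕ) : ℕ → ℕ
  | 0 => m
  | n + 1 => c (a + n)

theorem foldl_fDiv_spec [FiniteDimensional KK V] {a m : ℕ} (ha : 1 ≤ a) {v : V} (hv : v ≠ 0)
    (hwt : IsWtVec G v (omWt a m)) (hhw : ∀ i, 1 ≤ i → i ≤ d → G.e i • v = 0) (c : ℕ → ℕ)
    (n : ℕ) (hn : a + n ≤ d + 1) {u : V}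
    (hu : u = (List.range n).foldl (fun u r => fDiv G (a + r) (c (a + r)) • u) v) :
    (∀ j, a + n ≤ j → j ≤ d → G.e j • u = 0 ∧
      G.K j • u = (qv ^ (if j = a + n then (chainTop c a m n : ℤ) else 0)) • u) ∧
    (u ≠ 0 ↔ ∀ r < n, c (a + r) ≤ chainTop c a m r) := by
  induction n generalizing u with
  | zero =>
    obtain rfl : u = v := by simpa using hu
    refine ⟨fun j hj hjd => ⟨hhw j (by omega) hjd, ?_⟩, by simpa using hv⟩
    simpa [omWt, chainTop] using hwt j (by omega) hjd
  | succ n ih =>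
    obtain ⟨h1, h2⟩ := ih (by omega) rfl
    rw [List.range_succ, List.foldl_append, List.foldl_cons, List.foldl_nil] at hu
    set w := (List.range n).foldl (fun u r => fDiv G (a + r) (c (a + r)) • u) v
    have hi : 1 ≤ a + n := by omega
    have hid : a + n ≤ d := by omega
    rw [fDiv, smul_assoc] at hu
    have hq := inv_ne_zero (qFact_ne_zero (c (a + n)))
    subst hu
    refine ⟨fun j hj hjd => ?_, ?_⟩
    · obtain ⟨he, hK⟩ := h1 j (by omega) hjd
      rw [smul_comm (G.e j), smul_comm (G.K j),
        K_smul_f_pow_smul G hi hid (by omega) hjd hK, ← mul_smul (G.e j),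
        (commute_e_f_pow_of_ne G hi hid (by omega) hjd (by omega) _).eq, mul_smul, he, smul_zero,
        smul_zero, smul_comm]
      refine ⟨rfl, ?_⟩
      congr 2
      rw [if_neg (by omega), cartan, if_neg (by omega)]
      by_cases hj' : j = a + (n + 1)
      · rw [if_pos (by omega), if_pos hj', chainTop]
        ring
      · rw [if_neg (by omega), if_neg hj']
        ring
    · obtain ⟨he, hK⟩ := h1 (a + n) le_rfl hid
      rw [if_pos rfl] at hK
      rw [smul_ne_zero_iff, f_pow_smul_ne_zero_iff G hi hid hK he, h2]
      simp only [Nat.forall_lt_succ_right, hq, ne_eq, not_false_eq_true, true_and]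

/-- Proposition `tech` (1):  for `λ = m ω_a`, the vector
`f_{a'}^{(c_{a'})} ⋯ f_a^{(c_a)} v_λ` is nonzero if and only if
`m ≥ c_a ≥ c_{a+1} ≥ ⋯ ≥ c_{a'} ≥ 0`. -/
theorem divided_power_chain_ne_zero_iff
    (k a m a' : ℕ) (hk : 2 ≤ k) (ha : 1 ≤ a) (hak : a ≤ k - 1) (hm : 1 ≤ m)
    (haa' : a ≤ a') (ha'k : a' ≤ k - 1)
    (G : QGroup (k - 1)) (V : Type) [AddCommGroup V] [Module KK V] [Module G.U V]
    [IsScalarTower KK G.U V]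
    (v : V) (hV : IsHWModule G (omWt a m) v) (c : ℕ → ℕ) :
    fDivChain G c a a' v ≠ 0 ↔
      (c a ≤ m ∧ ∀ i, a ≤ i → i < a' → c (i + 1) ≤ c i) := by
  have := hV.findim
  rw [fDivChain, (foldl_fDiv_spec G ha hV.ne_zero hV.wt hV.hw c (a' + 1 - a) (by omega) rfl).2]
  constructor
  · refine fun h => ⟨h 0 (by omega), fun i hai hia' => ?_⟩
    obtain ⟨r, rfl⟩ := Nat.exists_eq_add_of_le hai
    exact h (r + 1) (by omega)
  · rintro ⟨h0, h⟩ (_ | r) hr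
    · exact h0
    · exact h (a + r) (by omega) (by omega)

end QSL
end
end
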